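/- arXiv:1203.2750 — 2 statements merged into one kernel-verified Lean document; each statement's English description precedes it below -/
import Mathlib

section
/- For every real d < 1/2, the series of squared fractional binomial coefficients converges and Σ_{j=0}^{∞} a_j(d)² = Γ(1−2d)/Γ(1−d)². In particular, for η ∈ (0,1/2), Σ_{j=0}^{∞} a_j(1/2−η)² = Γ(2η)/Γ(1/2+η)², a quantity which tends to +∞ as η ↓ 0. -/
open scoped BigOperators

noncomputable section

/-- Fractional binomial coefficients `a_j(ζ) = ∏_{k=1}^j (ζ+k-1)/k = Γ(j+ζ)/(Γ(ζ)Γ(j+1))`. -/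
def fracA (ζ : ℝ) (j : ℕ) : ℝ := ∏ k ∈ Finset.range j, (ζ + k) / (k + 1)

open Filter Topology

/-- The terms of the hypergeometric series `₂F₁(d, d; n + 1; 1)`. -/
def gaussTerm (d : ℝ) (n j : ℕ) : ℝ :=
  ∏ k ∈ Finset.range j, (d + k) ^ 2 / ((k + 1) * (k + 1 + n))

lemma gaussTerm_succ (d : ℝ) (n j : ℕ) :
    gaussTerm d n (j + 1) = gaussTerm d n j * ((d + j) ^ 2 / ((j + 1) * (j + 1 + n))) :=
  Finset.prod_range_succ _ _

lemma gaussTerm_zero_right (d : ℝ) (n : ℕ) : gaussTerm d n 0 = 1 :=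
  Finset.prod_range_zero _

lemma gaussTerm_nonneg (d : ℝ) (n j : ℕ) : 0 ≤ gaussTerm d n j :=
  Finset.prod_nonneg fun _ _ => by positivity

lemma gaussTerm_zero_left (d : ℝ) (j : ℕ) : gaussTerm d 0 j = fracA d j ^ 2 := by
  rw [gaussTerm, fracA, ← Finset.prod_pow]
  refine Finset.prod_congr rfl fun k _ => ?_
  rw [div_pow, Nat.cast_zero, add_zero, ← sq]

lemma gaussTerm_le (d : ℝ) (n j : ℕ) : gaussTerm d n j ≤ gaussTerm d 0 j := by
  refine Finset.prod_le_prod (fun _ _ => by positivity) fun k _ => ?_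
  rw [Nat.cast_zero]
  gcongr
  positivity

lemma gaussTerm_succ_left (d : ℝ) (n j : ℕ) :
    gaussTerm d (n + 1) j = gaussTerm d n j * ((n + 1) / (n + 1 + j)) := by
  induction j with
  | zero =>
    have : (n : ℝ) + 1 ≠ 0 := by positivity
    simp [gaussTerm_zero_right, this]
  | succ j ih =>
    have h1 : (n : ℝ) + 1 + j ≠ 0 := by positivity
    have h2 : (j : ℝ) + 1 + n ≠ 0 := by positivity
    have h3 : (j : ℝ) + 1 + (n + 1) ≠ 0 := by positivity
    have h4 : (n : ℝ) + 1 + (j + 1) ≠ 0 := by positivity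
    have h5 : (j : ℝ) + 1 ≠ 0 := by positivity
    rw [gaussTerm_succ, gaussTerm_succ, ih]
    push_cast
    field_simp
    ring

lemma gaussTerm_telescope (d : ℝ) (n j : ℕ) :
    (n + 1) * (n + 1 - 2 * d) * gaussTerm d n j - (n + 1 - d) ^ 2 * gaussTerm d (n + 1) j =
      (n + 1) * (j * gaussTerm d n j - ((j + 1 : ℕ) : ℝ) * gaussTerm d n (j + 1)) := by
  have h1 : (n : ℝ) + 1 + j ≠ 0 := by positivity
  have h2 : (j : ℝ) + 1 + n ≠ 0 := by positivity
  have h5 : (j : ℝ) + 1 ≠ 0 := by positivity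
  rw [gaussTerm_succ, gaussTerm_succ_left]
  push_cast
  field_simp
  ring

lemma gaussTerm_zero_le_sub {d : ℝ} (hd : d < 1 / 2) :
    ∃ J : ℕ, ∀ j ≥ J, (1 - 2 * d) / 2 * gaussTerm d 0 j ≤
      j * gaussTerm d 0 j - ((j + 1 : ℕ) : ℝ) * gaussTerm d 0 (j + 1) := by
  have hd' : 0 < 1 - 2 * d := by linarith
  obtain ⟨J, hJ⟩ := exists_nat_ge ((2 * d ^ 2 + (1 - 2 * d)) / (1 - 2 * d))
  refine ⟨J, fun j hj => ?_⟩
  have hj' : (J : ℝ) ≤ j := by exact_mod_cast hj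
  have hle : 2 * d ^ 2 + (1 - 2 * d) ≤ j * (1 - 2 * d) := by
    rw [← div_le_iff₀ hd']
    exact hJ.trans hj'
  have key : (j : ℝ) * gaussTerm d 0 j - ((j + 1 : ℕ) : ℝ) * gaussTerm d 0 (j + 1) =
      ((1 - 2 * d) * j - d ^ 2) / (j + 1) * gaussTerm d 0 j := by
    have h5 : (j : ℝ) + 1 ≠ 0 := by positivity
    rw [gaussTerm_succ]
    push_cast
    rw [add_zero]
    field_simp
    ring
  rw [key]
  refine mul_le_mul_of_nonneg_right ?_ (gaussTerm_nonneg _ _ _)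
  rw [le_div_iff₀ (by positivity)]
  linarith

lemma summable_gaussTerm_zero {d : ℝ} (hd : d < 1 / 2) : Summable (gaussTerm d 0) := by
  have hd' : 0 < (1 - 2 * d) / 2 := by linarith
  obtain ⟨J, hJ⟩ := gaussTerm_zero_le_sub hd
  rw [← summable_nat_add_iff J]
  refine summable_of_sum_range_le (c := J * gaussTerm d 0 J / ((1 - 2 * d) / 2))
    (fun _ => gaussTerm_nonneg _ _ _) fun N => ?_
  rw [le_div_iff₀ hd', mul_comm, Finset.mul_sum]
  calc ∑ i ∈ Finset.range N, (1 - 2 * d) / 2 * gaussTerm d 0 (i + J)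
      ≤ ∑ i ∈ Finset.range N, (((i + J : ℕ) : ℝ) * gaussTerm d 0 (i + J) -
          ((i + 1 + J : ℕ) : ℝ) * gaussTerm d 0 (i + 1 + J)) := by
        refine Finset.sum_le_sum fun i _ => ?_
        rw [add_right_comm i 1 J]
        exact hJ _ (Nat.le_add_left _ _)
    _ = J * gaussTerm d 0 J - ((N + J : ℕ) : ℝ) * gaussTerm d 0 (N + J) := by
        rw [Finset.sum_range_sub' fun i : ℕ => ((i + J : ℕ) : ℝ) * gaussTerm d 0 (i + J)]
        simp
    _ ≤ J * gaussTerm d 0 J :=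
        sub_le_self _ (mul_nonneg (Nat.cast_nonneg _) (gaussTerm_nonneg _ _ _))

lemma tendsto_mul_gaussTerm_zero {d : ℝ} (hd : d < 1 / 2) :
    Tendsto (fun j : ℕ => j * gaussTerm d 0 j) atTop (𝓝 0) := by
  have hd' : 0 < (1 - 2 * d) / 2 := by linarith
  obtain ⟨J, hJ⟩ := gaussTerm_zero_le_sub hd
  have hnn : ∀ j : ℕ, 0 ≤ j * gaussTerm d 0 j := fun j =>
    mul_nonneg (Nat.cast_nonneg _) (gaussTerm_nonneg _ _ _)
  have hanti : Antitone fun i : ℕ => ((i + J : ℕ) : ℝ) * gaussTerm d 0 (i + J) := by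
    refine antitone_nat_of_succ_le fun i => ?_
    have h := hJ (i + J) (Nat.le_add_left _ _)
    have := mul_nonneg hd'.le (gaussTerm_nonneg d 0 (i + J))
    rw [add_right_comm i 1 J]
    linarith
  have hlim := tendsto_atTop_ciInf hanti ⟨0, by rintro _ ⟨i, rfl⟩; exact hnn _⟩
  set L := ⨅ i : ℕ, ((i + J : ℕ) : ℝ) * gaussTerm d 0 (i + J)
  have hlim' : Tendsto (fun j : ℕ => j * gaussTerm d 0 j) atTop (𝓝 L) :=
    (tendsto_add_atTop_iff_nat J).1 hlim
  suffices hL : L = 0 by rwa [hL] at hlim'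
  by_contra hL
  have hLpos : 0 < L := lt_of_le_of_ne (ge_of_tendsto' hlim' hnn) (Ne.symm hL)
  refine Real.not_summable_one_div_natCast ?_
  refine summable_of_isBigO_nat (summable_gaussTerm_zero hd)
    (Asymptotics.IsBigO.of_bound (2 / L) ?_)
  filter_upwards [hlim'.eventually (lt_mem_nhds (half_lt_self hLpos)), eventually_gt_atTop 0]
    with j hj hj0
  have hj0' : (0 : ℝ) < j := by exact_mod_cast hj0
  rw [Real.norm_of_nonneg (by positivity), Real.norm_of_nonneg (gaussTerm_nonneg _ _ _),
    div_mul_eq_mul_div, div_le_div_iff₀ hj0' hLpos]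
  linarith

lemma summable_gaussTerm {d : ℝ} (hd : d < 1 / 2) (n : ℕ) : Summable (gaussTerm d n) :=
  (summable_gaussTerm_zero hd).of_nonneg_of_le (gaussTerm_nonneg d n) (gaussTerm_le d n)

lemma tsum_gaussTerm_succ {d : ℝ} (hd : d < 1 / 2) (n : ℕ) :
    (n + 1) * (n + 1 - 2 * d) * ∑' j, gaussTerm d n j =
      (n + 1 - d) ^ 2 * ∑' j, gaussTerm d (n + 1) j := by
  have hu : Tendsto (fun j : ℕ => j * gaussTerm d n j) atTop (𝓝 0) :=
    squeeze_zero (fun j => mul_nonneg (Nat.cast_nonneg _) (gaussTerm_nonneg _ _ _))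
      (fun j => mul_le_mul_of_nonneg_left (gaussTerm_le _ _ _) (Nat.cast_nonneg _))
      (tendsto_mul_gaussTerm_zero hd)
  have hs := ((summable_gaussTerm hd n).hasSum.mul_left ((n + 1) * (n + 1 - 2 * d))).sub
    ((summable_gaussTerm hd (n + 1)).hasSum.mul_left ((n + 1 - d) ^ 2))
  have hz : Tendsto (fun N : ℕ => -((n : ℝ) + 1) * (N * gaussTerm d n N)) atTop (𝓝 0) := by
    simpa using hu.const_mul (-((n : ℝ) + 1))
  refine sub_eq_zero.1 (tendsto_nhds_unique hs.tendsto_sum_nat (hz.congr fun N => ?_))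
  rw [Finset.sum_congr rfl fun j _ => gaussTerm_telescope d n j, ← Finset.mul_sum,
    Finset.sum_range_sub' fun j : ℕ => (j : ℝ) * gaussTerm d n j]
  rw [Nat.cast_zero]
  ring

lemma tsum_gaussTerm_zero_eq_prod_mul {d : ℝ} (hd : d < 1 / 2) (n : ℕ) :
    ∑' j, gaussTerm d 0 j =
      (∏ k ∈ Finset.range n, ((k : ℝ) + 1 - d) ^ 2 / ((k + 1) * (k + 1 - 2 * d))) *
        ∑' j, gaussTerm d n j := by
  induction n with
  | zero => simp
  | succ n ih =>
    have h1 : (0 : ℝ) < n + 1 - 2 * d := by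
      have : (0 : ℝ) ≤ n := Nat.cast_nonneg n
      linarith
    have h2 : (0 : ℝ) < n + 1 := by positivity
    rw [ih, Finset.prod_range_succ, mul_assoc, div_mul_eq_mul_div, ← tsum_gaussTerm_succ hd n,
      mul_div_cancel_left₀ _ (mul_pos h2 h1).ne']

lemma tendsto_tsum_gaussTerm {d : ℝ} (hd : d < 1 / 2) :
    Tendsto (fun n => ∑' j, gaussTerm d n j) atTop (𝓝 1) := by
  have hsum : ∑' j : ℕ, (if j = 0 then (1 : ℝ) else 0) = 1 := tsum_ite_eq 0 _
  rw [← hsum]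
  refine tendsto_tsum_of_dominated_convergence (summable_gaussTerm_zero hd) (fun j => ?_)
    (Eventually.of_forall fun n j => ?_)
  · rcases j with _ | j
    · simp [gaussTerm_zero_right]
    · have hlim : Tendsto (fun n : ℕ => gaussTerm d 0 j * (d + j) ^ 2 / (n : ℝ)) atTop (𝓝 0) :=
        tendsto_const_div_atTop_nhds_zero_nat _
      rw [if_neg (Nat.succ_ne_zero j)]
      refine squeeze_zero' (Eventually.of_forall fun n => gaussTerm_nonneg _ _ _) ?_ hlim
      filter_upwards [eventually_gt_atTop 0] with n hn
      have hn' : (0 : ℝ) < n := by exact_mod_cast hn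
      rw [gaussTerm_succ, mul_div_assoc]
      refine mul_le_mul (gaussTerm_le _ _ _) ?_ (by positivity) (gaussTerm_nonneg _ _ _)
      refine div_le_div_of_nonneg_left (by positivity) hn' ?_
      have hj : (0 : ℝ) ≤ j := Nat.cast_nonneg j
      nlinarith
  · rw [Real.norm_of_nonneg (gaussTerm_nonneg _ _ _)]
    exact gaussTerm_le _ _ _

lemma prod_mul_eq_GammaSeq_div {d : ℝ} (hd : d < 1 / 2) {n : ℕ} (hn : n ≠ 0) :
    (∏ k ∈ Finset.range (n + 1), ((k : ℝ) + 1 - d) ^ 2 / ((k + 1) * (k + 1 - 2 * d))) *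
        (((n + 1 : ℕ) : ℝ) / n) =
      Real.GammaSeq (1 - 2 * d) n / Real.GammaSeq (1 - d) n ^ 2 := by
  have hn' : (0 : ℝ) < n := by positivity
  have hfac : ∏ k ∈ Finset.range (n + 1), ((k : ℝ) + 1) = (n + 1) * n.factorial := by
    have h := Finset.prod_range_add_one_eq_factorial (n + 1)
    rw [Nat.factorial_succ] at h
    exact_mod_cast h
  have hpow : (n : ℝ) ^ (1 - d) * (n : ℝ) ^ (1 - d) = n * (n : ℝ) ^ (1 - 2 * d) := by
    rw [← Real.rpow_add hn', ← Real.rpow_one_add' hn'.le (by linarith)]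
    congr 1
    ring
  have hA : ∏ k ∈ Finset.range (n + 1), ((k : ℝ) + 1 - d) =
      ∏ k ∈ Finset.range (n + 1), (1 - d + (k : ℝ)) :=
    Finset.prod_congr rfl fun k _ => by ring
  have hB : ∏ k ∈ Finset.range (n + 1), ((k : ℝ) + 1 - 2 * d) =
      ∏ k ∈ Finset.range (n + 1), (1 - 2 * d + (k : ℝ)) :=
    Finset.prod_congr rfl fun k _ => by ring
  have hA0 : ∏ k ∈ Finset.range (n + 1), (1 - d + (k : ℝ)) ≠ 0 :=
    (Finset.prod_pos fun k _ => by have := Nat.cast_nonneg (α := ℝ) k; linarith).ne'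
  have hB0 : ∏ k ∈ Finset.range (n + 1), (1 - 2 * d + (k : ℝ)) ≠ 0 :=
    (Finset.prod_pos fun k _ => by have := Nat.cast_nonneg (α := ℝ) k; linarith).ne'
  rw [Finset.prod_div_distrib, Finset.prod_mul_distrib, Finset.prod_pow, hfac, hA, hB,
    Real.GammaSeq, Real.GammaSeq]
  set A := ∏ k ∈ Finset.range (n + 1), (1 - d + (k : ℝ))
  set B := ∏ k ∈ Finset.range (n + 1), (1 - 2 * d + (k : ℝ))
  have hp1 : (n : ℝ) ^ (1 - d) ≠ 0 := (Real.rpow_pos_of_pos hn' _).ne'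
  have hp2 : (n : ℝ) ^ (1 - 2 * d) ≠ 0 := (Real.rpow_pos_of_pos hn' _).ne'
  set p := (n : ℝ) ^ (1 - d)
  set q := (n : ℝ) ^ (1 - 2 * d)
  have hf : (n.factorial : ℝ) ≠ 0 := by positivity
  have hn1 : (n : ℝ) + 1 ≠ 0 := by positivity
  have hpow' : p ^ 2 = n * q := by rw [sq, hpow]
  push_cast
  rw [div_pow, mul_pow, hpow']
  field_simp

theorem tsum_gaussTerm_zero {d : ℝ} (hd : d < 1 / 2) :
    ∑' j, gaussTerm d 0 j = Real.Gamma (1 - 2 * d) / Real.Gamma (1 - d) ^ 2 := by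
  have hG : Real.Gamma (1 - d) ≠ 0 := (Real.Gamma_pos_of_pos (by linarith)).ne'
  have hseq : Tendsto (fun n : ℕ => Real.GammaSeq (1 - 2 * d) n / Real.GammaSeq (1 - d) n ^ 2)
      atTop (𝓝 (Real.Gamma (1 - 2 * d) / Real.Gamma (1 - d) ^ 2)) :=
    (Real.GammaSeq_tendsto_Gamma _).div ((Real.GammaSeq_tendsto_Gamma _).pow 2)
      (pow_ne_zero 2 hG)
  have hratio : Tendsto (fun n : ℕ => ((n + 1 : ℕ) : ℝ) / n) atTop (𝓝 1) := by
    have h := tendsto_const_nhds (x := (1 : ℝ)).add (tendsto_one_div_atTop_nhds_zero_nat (𝕜 := ℝ))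
    rw [add_zero] at h
    refine h.congr' ?_
    filter_upwards [eventually_ne_atTop 0] with n hn
    have hn' : (n : ℝ) ≠ 0 := by exact_mod_cast hn
    push_cast
    field_simp
  have hleft := hratio.const_mul (∑' j, gaussTerm d 0 j)
  have hright := hseq.mul ((tendsto_tsum_gaussTerm hd).comp (tendsto_add_atTop_nat 1))
  rw [mul_one] at hleft hright
  refine tendsto_nhds_unique hleft (hright.congr' ?_)
  filter_upwards [eventually_ne_atTop 0] with n hn
  rw [← prod_mul_eq_GammaSeq_div hd hn, tsum_gaussTerm_zero_eq_prod_mul hd (n + 1),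
    Function.comp_apply]
  ring

lemma tendsto_Gamma_two_mul_div_sq :
    Tendsto (fun η : ℝ => Real.Gamma (2 * η) / (Real.Gamma (1 / 2 + η)) ^ 2)
      (𝓝[>] 0) atTop := by
  have hG : ∀ s : ℝ, 0 < s → ContinuousAt Real.Gamma s := fun s hs =>
    (Real.differentiableAt_Gamma fun m => by
      have := Nat.cast_nonneg (α := ℝ) m
      linarith).continuousAt
  have hhalf : 0 < Real.Gamma (1 / 2) := Real.Gamma_pos_of_pos (by norm_num)
  have hnum : Tendsto (fun η : ℝ => Real.Gamma (2 * η + 1)) (𝓝[>] 0) (𝓝 1) := by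
    have h : ContinuousAt (fun η : ℝ => Real.Gamma (2 * η + 1)) 0 :=
      ContinuousAt.comp (g := Real.Gamma) (hG _ (by norm_num)) (by fun_prop)
    simpa [ContinuousAt] using h.tendsto.mono_left nhdsWithin_le_nhds
  have hden : Tendsto (fun η : ℝ => Real.Gamma (1 / 2 + η)) (𝓝[>] 0)
      (𝓝 (Real.Gamma (1 / 2))) := by
    have h : ContinuousAt (fun η : ℝ => Real.Gamma (1 / 2 + η)) 0 :=
      ContinuousAt.comp (g := Real.Gamma) (hG _ (by norm_num)) (by fun_prop)
    simpa only [add_zero] using h.tendsto.mono_left nhdsWithin_le_nhds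
  have hquot := (hnum.div (hden.pow 2) (pow_ne_zero 2 hhalf.ne')).mul_const (1 / 2)
  refine (tendsto_inv_nhdsGT_zero.atTop_mul_pos (by positivity) hquot).congr' ?_
  filter_upwards [self_mem_nhdsWithin] with η hη
  have hη' : η ≠ 0 := ne_of_gt hη
  simp only [Pi.div_apply]
  rw [Real.Gamma_add_one (mul_ne_zero two_ne_zero hη')]
  field_simp

/-- for d < 1/2, `Σ_{j≥0} a_j(d)² = Γ(1−2d)/Γ(1−d)²` (the series converging);
in particular for η ∈ (0,1/2), `Σ_{j≥0} a_j(1/2−η)² = Γ(2η)/Γ(1/2+η)²`, which tends to +∞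
as η ↓ 0. -/
theorem fracA_sq_summable :
    (∀ d : ℝ, d < 1 / 2 →
      Summable (fun j : ℕ => (fracA d j) ^ 2) ∧
      (∑' j : ℕ, (fracA d j) ^ 2) = Real.Gamma (1 - 2 * d) / (Real.Gamma (1 - d)) ^ 2) ∧
    (∀ η : ℝ, η ∈ Set.Ioo (0 : ℝ) (1 / 2) →
      (∑' j : ℕ, (fracA (1 / 2 - η) j) ^ 2) =
        Real.Gamma (2 * η) / (Real.Gamma (1 / 2 + η)) ^ 2) ∧
    Filter.Tendsto (fun η : ℝ => Real.Gamma (2 * η) / (Real.Gamma (1 / 2 + η)) ^ 2)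
      (nhdsWithin 0 (Set.Ioi 0)) Filter.atTop := by
  have hmain : ∀ d : ℝ, d < 1 / 2 →
      Summable (fun j : ℕ => (fracA d j) ^ 2) ∧
      (∑' j : ℕ, (fracA d j) ^ 2) = Real.Gamma (1 - 2 * d) / (Real.Gamma (1 - d)) ^ 2 := by
    intro d hd
    simp only [← gaussTerm_zero_left]
    exact ⟨summable_gaussTerm_zero hd, tsum_gaussTerm_zero hd⟩
  refine ⟨hmain, fun η hη => ?_, tendsto_Gamma_two_mul_div_sq⟩
  rw [(hmain (1 / 2 - η) (by linarith [hη.1])).2]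
  ring_nf
end
end

section
/- For every real d > −1/2, lim_{n→∞} n^{−(2d+1)} Σ_{j=0}^{n−1} a_j(d+1)² = 1/((2d+1) Γ(d+1)²). Equivalently, with b_{j,n}(d+1) = a_j(d+1)/n^{d}, one has (1/n) Σ_{j=0}^{n−1} b_{j,n}(d+1)² → ∫_0^1 x^{2d} dx / Γ(d+1)² = 1/((2d+1)Γ(d+1)²), which is the variance (divided by σ0²) of the limiting random variable ∫_0^1 (1−s)^{d} dB(s)/Γ(d+1) of h_n, where B is Brownian motion with variance σ0². -/
open scoped BigOperators

noncomputable section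

open Filter Topology Asymptotics

theorem tendsto_sum_range_div_sum_range {f g : ℕ → ℝ} {c : ℝ} (hg : ∀ n, 0 < g n)
    (hsum : Tendsto (fun n => ∑ i ∈ Finset.range n, g i) atTop atTop)
    (h : Tendsto (fun n => f n / g n) atTop (𝓝 c)) :
    Tendsto (fun n => (∑ i ∈ Finset.range n, f i) / ∑ i ∈ Finset.range n, g i) atTop (𝓝 c) := by
  have hlo : (fun n => f n - c * g n) =o[atTop] g := by
    rw [isLittleO_iff_tendsto fun n hn => absurd hn (hg n).ne']
    have := h.sub_const c
    rw [sub_self] at this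
    refine this.congr fun n => ?_
    have := (hg n).ne'
    field_simp
  have hs := (hlo.sum_range (fun n => (hg n).le) hsum).tendsto_div_nhds_zero.add_const c
  rw [zero_add] at hs
  refine hs.congr' ?_
  filter_upwards [hsum.eventually_gt_atTop 0] with n hn
  rw [Finset.sum_sub_distrib, ← Finset.mul_sum]
  field_simp
  ring

theorem tendsto_succ_rpow_sub_rpow_div (s : ℝ) :
    Tendsto (fun n : ℕ => (((n : ℝ) + 1) ^ s - (n : ℝ) ^ s) / (n : ℝ) ^ (s - 1)) atTop (𝓝 s) := by
  have hd : HasDerivAt (fun x : ℝ => x ^ s) s 1 := by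
    simpa using Real.hasDerivAt_rpow_const (x := 1) (p := s) (Or.inl one_ne_zero)
  have hinv : Tendsto (fun n : ℕ => ((n : ℝ))⁻¹) atTop (𝓝[≠] 0) := by
    refine tendsto_nhdsWithin_iff.2 ⟨tendsto_inv_atTop_nhds_zero_nat, ?_⟩
    filter_upwards [eventually_gt_atTop 0] with n hn
    have : (n : ℝ) ≠ 0 := by positivity
    simpa using this
  refine (hd.tendsto_slope_zero.comp hinv).congr' ?_
  filter_upwards [eventually_gt_atTop 0] with n hn
  have hn' : (0 : ℝ) < n := by exact_mod_cast hn
  have h1 : (n : ℝ) + 1 = n * (1 + (n : ℝ)⁻¹) := by field_simp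
  have h2 : (0 : ℝ) < 1 + (n : ℝ)⁻¹ := by positivity
  rw [h1, Real.mul_rpow hn'.le h2.le, Real.rpow_sub_one hn'.ne']
  have := (Real.rpow_pos_of_pos hn' s).ne'
  simp only [Function.comp, smul_eq_mul, inv_inv, Real.one_rpow]
  field_simp

theorem fracA_eq_prod_div_factorial (ζ : ℝ) (n : ℕ) :
    fracA ζ n = (∏ k ∈ Finset.range n, (ζ + k)) / (n.factorial : ℝ) := by
  rw [fracA, Finset.prod_div_distrib, ← Finset.prod_range_add_one_eq_factorial]
  push_cast
  rfl

theorem tendsto_fracA_div_rpow {ζ : ℝ} (hζ : 0 < ζ) :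
    Tendsto (fun n : ℕ => fracA ζ n / (n : ℝ) ^ (ζ - 1)) atTop (𝓝 (Real.Gamma ζ)⁻¹) := by
  have h1 := (Real.GammaSeq_tendsto_Gamma ζ).inv₀ (Real.Gamma_pos_of_pos hζ).ne'
  have h2 : Tendsto (fun n : ℕ => (n : ℝ) / (n + ζ)) atTop (𝓝 1) :=
    tendsto_natCast_div_add_atTop ζ
  have h3 := h1.mul h2
  rw [mul_one] at h3
  refine h3.congr' ?_
  filter_upwards [eventually_gt_atTop 0] with n hn
  have hn' : (0 : ℝ) < n := by exact_mod_cast hn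
  have hp := (Real.rpow_pos_of_pos hn' ζ).ne'
  have hf : (n.factorial : ℝ) ≠ 0 := by positivity
  have hz : (n : ℝ) + ζ ≠ 0 := by positivity
  rw [Real.GammaSeq, fracA_eq_prod_div_factorial, Finset.prod_range_succ, add_comm ζ (n : ℝ),
    Real.rpow_sub_one hn'.ne']
  field_simp

/-- for d > −1/2,
`n^{−(2d+1)} Σ_{j=0}^{n−1} a_j(d+1)² → 1/((2d+1)Γ(d+1)²)`, which equals
`(∫_0^1 x^{2d} dx)/Γ(d+1)²`. -/
theorem fracA_sq_partial_sum_limit (d : ℝ) (hd : -(1 / 2) < d) :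
    Filter.Tendsto
      (fun n : ℕ => (n : ℝ) ^ (-(2 * d + 1)) * ∑ j ∈ Finset.range n, (fracA (d + 1) j) ^ 2)
      Filter.atTop (nhds (1 / ((2 * d + 1) * (Real.Gamma (d + 1)) ^ 2))) ∧
    (∫ x in Set.Ioc (0 : ℝ) 1, x ^ (2 * d)) / (Real.Gamma (d + 1)) ^ 2
      = 1 / ((2 * d + 1) * (Real.Gamma (d + 1)) ^ 2) := by
  have hs : 0 < 2 * d + 1 := by linarith
  have hΓ : Real.Gamma (d + 1) ≠ 0 := (Real.Gamma_pos_of_pos (by linarith)).ne'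
  constructor
  · have hsum (n : ℕ) : ∑ j ∈ Finset.range n,
        (((j : ℝ) + 1) ^ (2 * d + 1) - (j : ℝ) ^ (2 * d + 1)) = (n : ℝ) ^ (2 * d + 1) := by
      have := Finset.sum_range_sub (fun j : ℕ => (j : ℝ) ^ (2 * d + 1)) n
      simpa [Real.zero_rpow hs.ne'] using this
    have hratio : Tendsto (fun n : ℕ => fracA (d + 1) n ^ 2 /
        (((n : ℝ) + 1) ^ (2 * d + 1) - (n : ℝ) ^ (2 * d + 1))) atTop
        (𝓝 (1 / ((2 * d + 1) * (Real.Gamma (d + 1)) ^ 2))) := by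
      have h := ((tendsto_fracA_div_rpow (ζ := d + 1) (by linarith)).pow 2).div
        (tendsto_succ_rpow_sub_rpow_div (2 * d + 1)) hs.ne'
      have hc : (Real.Gamma (d + 1))⁻¹ ^ 2 / (2 * d + 1)
          = 1 / ((2 * d + 1) * (Real.Gamma (d + 1)) ^ 2) := by
        field_simp
      rw [hc] at h
      refine h.congr' ?_
      filter_upwards [eventually_gt_atTop 0] with n hn
      have hn' : (0 : ℝ) < n := by exact_mod_cast hn
      have hp : ((n : ℝ) ^ d) ^ 2 = (n : ℝ) ^ (2 * d) := by
        rw [← Real.rpow_mul_natCast hn'.le, Nat.cast_ofNat, mul_comm]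
      simp only [Pi.div_apply, add_sub_cancel_right, div_pow, hp]
      exact div_div_div_cancel_right₀ (Real.rpow_pos_of_pos hn' _).ne' _ _
    have hlim := tendsto_sum_range_div_sum_range
      (fun n => sub_pos.2 (Real.rpow_lt_rpow n.cast_nonneg (lt_add_one _) hs))
      (by simpa only [hsum, Function.comp_def] using
        (tendsto_rpow_atTop hs).comp tendsto_natCast_atTop_atTop) hratio
    refine hlim.congr fun n => ?_
    rw [hsum, Real.rpow_neg n.cast_nonneg, div_eq_inv_mul]
  · rw [← intervalIntegral.integral_of_le zero_le_one,
      integral_rpow (Or.inl (by linarith)), Real.one_rpow, Real.zero_rpow hs.ne', sub_zero,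
      div_div]
end
end
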